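/- arXiv:2409.09544 — 2 statements merged into one kernel-verified Lean document; each statement's English description precedes it below -/
import Mathlib

section
/- Let ε, ε' ∈ {0,1}^k be binary sequences that differ at exactly one position r. Then the rational function P(ε;b) − P(ε';b) admits an expression f/g with polynomials f, g in the variables (a, x) such that the linear polynomial M(ε;b;r) (which equals M(ε';b;r)) does not divide g. -/
/- STATEMENT 4 (Lemma `lemma_alg2` in the paper): if binary sequences `ε, ε'` of
length `k` differ at exactly one position `r`, then `P(ε;b) − P(ε';b)` can be
written as `f/g` with polynomials `f, g` such that the linear polynomial
`M(ε;b;r) = M(ε';b;r)` does not divide `g`.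
We work in `ℝ[b_1, b_2, …] = MvPolynomial ℕ ℝ`, with the variables `b_1, …, b_{k+m}`
being `X 1, …, X (k+m)` (so `a_i = X i` for `1 ≤ i ≤ k` and `x_i = X (k+i)`), and in
its fraction field. Binary sequences are functions `ℕ → Bool` (only the values at
positions `1, …, k` matter). -/

open scoped BigOperators

noncomputable section

/-- `δ^ε = (1, ε_1, …, ε_k, 0, …, 0)`, 1-indexed: `deltaSeq k ε i` is `δ^ε_i`. -/
def deltaSeq (k : ℕ) (ε : ℕ → Bool) (i : ℕ) : Bool :=
  if i = 1 then true else if 2 ≤ i ∧ i ≤ k + 1 then ε (i - 1) else false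

/-- `L(δ^ε, j) = max { i ≤ j : δ^ε_i = 1 }`. -/
def Lidx (k : ℕ) (ε : ℕ → Bool) (j : ℕ) : ℕ :=
  Nat.findGreatest (fun i => deltaSeq k ε i = true) j

/-- `M(ε; b; j) = Σ_{ℓ = L(δ^ε,j)}^{j} b_ℓ`. -/
def Mpoly (k : ℕ) (ε : ℕ → Bool) (j : ℕ) : MvPolynomial ℕ ℝ :=
  ∑ ℓ ∈ Finset.Icc (Lidx k ε j) j, MvPolynomial.X ℓ

/-- `P(ε; b) = ∏_{j=1}^{k+m} 1/M(ε;b;j)`, an element of the fraction field. -/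
def Pfun (k m : ℕ) (ε : ℕ → Bool) : FractionRing (MvPolynomial ℕ ℝ) :=
  ∏ j ∈ Finset.Icc 1 (k + m),
    (algebraMap (MvPolynomial ℕ ℝ) (FractionRing (MvPolynomial ℕ ℝ)) (Mpoly k ε j))⁻¹

open MvPolynomial in
/-- Each step either restarts the partial sum (when `δ^ε` is `1`) or adds one variable to it. -/
theorem Mpoly_succ (k : ℕ) (ε : ℕ → Bool) (j : ℕ) :
    Mpoly k ε (j + 1) =
      (if deltaSeq k ε (j + 1) = true then 0 else Mpoly k ε j) + X (j + 1) := by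
  unfold Mpoly Lidx
  rw [Nat.findGreatest_succ]
  split_ifs with h
  · simp
  · rw [Finset.sum_Icc_succ_top ((Nat.findGreatest_le j).trans (Nat.le_succ j))]

theorem Mpoly_congr (k : ℕ) {ε ε' : ℕ → Bool} {j : ℕ}
    (h : ∀ i, 1 ≤ i → i ≤ j → deltaSeq k ε i = deltaSeq k ε' i) :
    Mpoly k ε j = Mpoly k ε' j := by
  induction j with
  | zero => simp [Mpoly, Lidx]
  | succ j ih =>
    rw [Mpoly_succ, Mpoly_succ, h (j + 1) (by omega) le_rfl,
      ih fun i hi hij => h i hi (hij.trans (Nat.le_succ j))]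

theorem deltaSeq_congr (k : ℕ) {ε ε' : ℕ → Bool} {r : ℕ}
    (h : ∀ i, 1 ≤ i → i ≤ k → i ≠ r → ε i = ε' i) {i : ℕ} (hi : i ≠ r + 1) :
    deltaSeq k ε i = deltaSeq k ε' i := by
  unfold deltaSeq
  split_ifs with h1 h2
  · rfl
  · exact h _ (by omega) (by omega) (by omega)
  · rfl

/-- Changing `δ^ε` at the single position `r + 1` does not change the later partial sums
modulo the partial sum at `r`. -/
theorem Mpoly_dvd_sub (k : ℕ) {ε ε' : ℕ → Bool} {r : ℕ}
    (h : ∀ i, i ≠ r + 1 → deltaSeq k ε i = deltaSeq k ε' i) (j : ℕ) :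
    Mpoly k ε r ∣ Mpoly k ε' j - Mpoly k ε j := by
  rcases le_or_gt j r with hj | hj
  · have hj' : Mpoly k ε j = Mpoly k ε' j := Mpoly_congr k fun i _ hij => h i (by omega)
    simp [hj']
  · induction j, hj using Nat.le_induction with
    | base =>
      have hr : Mpoly k ε' r = Mpoly k ε r :=
        (Mpoly_congr k fun i _ hij => h i (by omega)).symm
      rw [Nat.succ_eq_add_one, Mpoly_succ, Mpoly_succ, hr]
      split_ifs <;> simp
    | succ j hj ih =>
      rw [Mpoly_succ, Mpoly_succ, h (j + 1) (by omega)]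
      split_ifs
      · simp
      · simpa using ih

theorem eval_one_Mpoly_pos (k : ℕ) (ε : ℕ → Bool) (j : ℕ) :
    0 < MvPolynomial.eval (fun _ => (1 : ℝ)) (Mpoly k ε j) := by
  have h : Lidx k ε j ≤ j := Nat.findGreatest_le j
  simp only [Mpoly, map_sum, MvPolynomial.eval_X]
  exact Finset.sum_pos (fun _ _ => one_pos) (Finset.nonempty_Icc.2 h)

/-- The point with all coordinates `1` except the `r`-th, which is chosen so that the partial sum
at `r` vanishes. -/
def zeroPoint (k : ℕ) (ε : ℕ → Bool) (r : ℕ) : ℕ → ℝ :=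
  Function.update (fun _ => 1) r
    (1 - MvPolynomial.eval (fun _ => (1 : ℝ)) (Mpoly k ε r))

theorem eval_zeroPoint_Mpoly_of_lt (k : ℕ) (ε ε' : ℕ → Bool) {r j : ℕ} (hj : j < r) :
    MvPolynomial.eval (zeroPoint k ε r) (Mpoly k ε' j) =
      MvPolynomial.eval (fun _ => (1 : ℝ)) (Mpoly k ε' j) := by
  simp only [Mpoly, map_sum, MvPolynomial.eval_X]
  refine Finset.sum_congr rfl fun i hi => ?_
  have : i ≠ r := by
    have := (Finset.mem_Icc.1 hi).2
    omega
  simp [zeroPoint, this]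

theorem eval_zeroPoint_Mpoly_self (k : ℕ) (ε : ℕ → Bool) {r : ℕ} (hr : 1 ≤ r) :
    MvPolynomial.eval (zeroPoint k ε r) (Mpoly k ε r) = 0 := by
  obtain ⟨s, rfl⟩ := Nat.exists_eq_add_of_le' hr
  have hs := eval_zeroPoint_Mpoly_of_lt k ε ε (Nat.lt_succ_self s)
  have hv : zeroPoint k ε (s + 1) (s + 1) =
      1 - MvPolynomial.eval (fun _ => (1 : ℝ)) (Mpoly k ε (s + 1)) := by
    simp [zeroPoint]
  rw [Mpoly_succ, map_add, MvPolynomial.eval_X, hv, Mpoly_succ, map_add, MvPolynomial.eval_X]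
  split_ifs
  · simp
  · rw [hs]
    ring

theorem eval_zeroPoint_Mpoly_pos (k : ℕ) {ε ε' : ℕ → Bool} {r j : ℕ} (hr : 1 ≤ r)
    (hM : Mpoly k ε r = Mpoly k ε' r) (hj : j ≠ r) :
    0 < MvPolynomial.eval (zeroPoint k ε r) (Mpoly k ε' j) := by
  rcases lt_or_gt_of_ne hj with hj | hj
  · rw [eval_zeroPoint_Mpoly_of_lt k ε ε' hj]
    exact eval_one_Mpoly_pos k ε' j
  · have hv : ∀ i, r < i → zeroPoint k ε r i = 1 := fun i hi => by
      simp [zeroPoint, hi.ne']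
    induction j, hj using Nat.le_induction with
    | base =>
      rw [Nat.succ_eq_add_one, Mpoly_succ, map_add, MvPolynomial.eval_X, hv _ (Nat.lt_succ_self r),
        ← hM]
      split_ifs <;> simp [eval_zeroPoint_Mpoly_self k ε hr]
    | succ j hj ih =>
      have ih := ih (by omega)
      rw [Mpoly_succ, map_add, MvPolynomial.eval_X, hv _ (by omega)]
      split_ifs
      · simp
      · positivity

theorem Finset.dvd_prod_sub_prod {R ι : Type*} [CommRing R] (s : Finset ι) (f g : ι → R) {q : R}
    (h : ∀ i ∈ s, q ∣ f i - g i) : q ∣ ∏ i ∈ s, f i - ∏ i ∈ s, g i := by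
  simp only [← Ideal.mem_span_singleton, ← Ideal.Quotient.eq, map_prod] at h ⊢
  exact Finset.prod_congr rfl h

theorem Pfun_eq (k m : ℕ) (ε : ℕ → Bool) {r : ℕ} (hr : r ∈ Finset.Icc 1 (k + m)) :
    Pfun k m ε =
      (algebraMap (MvPolynomial ℕ ℝ) (FractionRing (MvPolynomial ℕ ℝ))
        (Mpoly k ε r * ∏ j ∈ (Finset.Icc 1 (k + m)).erase r, Mpoly k ε j))⁻¹ := by
  rw [Finset.mul_prod_erase _ _ hr, map_prod, Pfun, Finset.prod_inv_distrib]

theorem alg_lemma_two (k m : ℕ) (hk : 1 ≤ k) (hm : 1 ≤ m)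
    (ε ε' : ℕ → Bool) (r : ℕ) (hr1 : 1 ≤ r) (hrk : r ≤ k)
    (hdiff : ε r ≠ ε' r)
    (hsame : ∀ i, 1 ≤ i → i ≤ k → i ≠ r → ε i = ε' i) :
    Mpoly k ε r = Mpoly k ε' r ∧
      ∃ f g : MvPolynomial ℕ ℝ, ¬ (Mpoly k ε r ∣ g) ∧
        Pfun k m ε - Pfun k m ε' =
          algebraMap (MvPolynomial ℕ ℝ) (FractionRing (MvPolynomial ℕ ℝ)) f /
            algebraMap (MvPolynomial ℕ ℝ) (FractionRing (MvPolynomial ℕ ℝ)) g := by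
  have hδ : ∀ i, i ≠ r + 1 → deltaSeq k ε i = deltaSeq k ε' i :=
    fun i hi => deltaSeq_congr k hsame hi
  have hM : Mpoly k ε r = Mpoly k ε' r := Mpoly_congr k fun i _ hi => hδ i (by omega)
  have hr : r ∈ Finset.Icc 1 (k + m) := Finset.mem_Icc.2 ⟨hr1, by omega⟩
  refine ⟨hM, ?_⟩
  set s := (Finset.Icc 1 (k + m)).erase r with hs
  have hpos : ∀ η : ℕ → Bool, Mpoly k ε r = Mpoly k η r →
      0 < MvPolynomial.eval (zeroPoint k ε r) (∏ j ∈ s, Mpoly k η j) := fun η hη => by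
    rw [map_prod]
    exact Finset.prod_pos fun j hj =>
      eval_zeroPoint_Mpoly_pos k hr1 hη (Finset.ne_of_mem_erase hj)
  have hA := hpos ε rfl
  have hA' := hpos ε' hM
  obtain ⟨h, hh⟩ := Finset.dvd_prod_sub_prod s (Mpoly k ε') (Mpoly k ε)
    fun j _ => Mpoly_dvd_sub k hδ j
  have hQ : Mpoly k ε r ≠ 0 := fun h0 => by
    have := eval_one_Mpoly_pos k ε r
    simp [h0] at this
  rw [Pfun_eq k m ε hr, Pfun_eq k m ε' hr, ← hs, ← hM]
  set A := ∏ j ∈ s, Mpoly k ε j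
  set A' := ∏ j ∈ s, Mpoly k ε' j
  have hA0 : A ≠ 0 := fun h0 => by simp [h0] at hA
  have hA0' : A' ≠ 0 := fun h0 => by simp [h0] at hA'
  refine ⟨h, A * A', ?_, ?_⟩
  · rintro ⟨c, hc⟩
    have := congrArg (MvPolynomial.eval (zeroPoint k ε r)) hc
    rw [map_mul, map_mul, eval_zeroPoint_Mpoly_self k ε hr1, zero_mul] at this
    exact (mul_pos hA hA').ne' this
  · have hinj := FaithfulSMul.algebraMap_injective (MvPolynomial ℕ ℝ)
      (FractionRing (MvPolynomial ℕ ℝ))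
    have hne := fun {p : MvPolynomial ℕ ℝ} (hp : p ≠ 0) => (map_ne_zero_iff _ hinj).2 hp
    have hh' := congrArg
      (algebraMap (MvPolynomial ℕ ℝ) (FractionRing (MvPolynomial ℕ ℝ))) hh
    have hQ1 := hne hQ
    have hA1 := hne hA0
    have hA1' := hne hA0'
    rw [map_sub, map_mul] at hh'
    simp only [map_mul]
    field_simp
    linear_combination hh'
end
end

section
/- Define Q(a,x) := Σ_{ε ∈ {0,1}^k} (−1)^{#1(ε)} · P(ε;b), where #1(ε) is the number of ones in ε. Then Q admits an expression f/g with polynomials f, g in (a,x) such that no linear polynomial of the form M(ε';b;t) with ε' ∈ {0,1}^k and 1 ≤ t ≤ k divides g. In particular, Q defines a holomorphic function in a neighborhood of every point (a⁰, x⁰) ∈ ℂ^k × ℂ^m with a⁰ = 0 at which none of the linear forms M(ε';b;j) with j > k and ε' ∈ {0,1}^k vanishes. -/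
/- STATEMENT 5 (Lemma `lemma_alg3` in the paper): the alternating sum
`Q(a,x) := Σ_{ε ∈ {0,1}^k} (−1)^{#1(ε)} P(ε;b)` can be written as `f/g` with
polynomials `f, g` such that no linear polynomial `M(ε';b;t)` with `1 ≤ t ≤ k`
divides `g`; in particular `Q` defines a holomorphic function near every point
`(a⁰,x⁰) ∈ ℂ^k × ℂ^m` with `a⁰ = 0` at which none of the linear forms `M(ε';b;j)`
with `j > k` vanishes.
We work in `ℝ[b_1, b_2, …] = MvPolynomial ℕ ℝ` with `b_ℓ = X ℓ` (1-indexed), i.e.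
`a_i = X i` for `1 ≤ i ≤ k` and `x_i = X (k+i)` for `1 ≤ i ≤ m`, and in its fraction
field; a point of `ℂ^k × ℂ^m` is a function `z : Fin (k+m) → ℂ` (with `z ⟨ℓ-1,_⟩`
the value of the variable `b_ℓ`). -/

open scoped BigOperators

noncomputable section

/-- Extension of a binary sequence `ε ∈ {0,1}^k` to a 1-indexed sequence `ℕ → Bool`. -/
def extSeq (k : ℕ) (ε : Fin k → Bool) : ℕ → Bool :=
  fun i => if h : 1 ≤ i ∧ i ≤ k then ε ⟨i - 1, by omega⟩ else false

/-- `#1(ε)`: the number of ones in `ε`. -/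
def numOnes (k : ℕ) (ε : Fin k → Bool) : ℕ :=
  (Finset.univ.filter fun i => ε i = true).card

/-- `Q(a,x) = Σ_{ε ∈ {0,1}^k} (−1)^{#1(ε)} P(ε;b)`. -/
def Qfun (k m : ℕ) : FractionRing (MvPolynomial ℕ ℝ) :=
  ∑ ε : Fin k → Bool, (-1 : FractionRing (MvPolynomial ℕ ℝ)) ^ numOnes k ε *
    Pfun k m (extSeq k ε)

/-- Evaluation of a polynomial in `b_1, …, b_{k+m}` at a complex point. -/
def evalC (k m : ℕ) (q : MvPolynomial ℕ ℝ) (z : Fin (k + m) → ℂ) : ℂ :=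
  MvPolynomial.eval
    (fun i : ℕ => if h : 1 ≤ i ∧ i ≤ k + m then z ⟨i - 1, by omega⟩ else 0)
    (MvPolynomial.map (algebraMap ℝ ℂ) q)

section IntervalSums

variable {K : Type*} [Field K] (b : ℕ → K) (k : ℕ)

/-- The interval sum `b_s + ⋯ + b_t`. -/
def intervalSum (s t : ℕ) : K := ∑ ℓ ∈ Finset.Icc s t, b ℓ

/-- The alternating sum over the entries `ε_{k+1-d}, …, ε_k` of the products of reciprocals of
block sums at the positions `k + 1 - d, …, t`, when the block containing the position
`k + 1 - d` starts at `L`. -/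
def tailSum (t : ℕ) : ℕ → ℕ → K
  | 0, L => ∏ i ∈ Finset.Icc (k + 1) t, (intervalSum b L i)⁻¹
  | d + 1, L => (intervalSum b L (k - d))⁻¹ * (tailSum t d L - tailSum t d (k - d + 1))

variable {b k}

lemma intervalSum_add {s j t : ℕ} (hsj : s ≤ j + 1) (hjt : j ≤ t) :
    intervalSum b s j + intervalSum b (j + 1) t = intervalSum b s t := by
  unfold intervalSum
  rw [← Finset.sum_union]
  · congr 1
    ext i
    simp only [Finset.mem_union, Finset.mem_Icc]
    omega
  · rw [Finset.disjoint_left]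
    intro i
    simp only [Finset.mem_Icc]
    omega

lemma tailSum_zero_succ {t : ℕ} (ht : k ≤ t) (L : ℕ) :
    tailSum b k (t + 1) 0 L = (intervalSum b L (t + 1))⁻¹ * tailSum b k t 0 L := by
  simp only [tailSum]
  rw [Finset.prod_Icc_succ_top (by omega), mul_comm]

lemma tailSum_succ (t d L : ℕ) : tailSum b k t (d + 1) L =
    (intervalSum b L (k - d))⁻¹ * (tailSum b k t d L - tailSum b k t d (k - d + 1)) :=
  rfl

lemma tailSum_self_succ (d L : ℕ) : tailSum b k k (d + 1) L = 0 := by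
  induction d generalizing L with
  | zero => simp [tailSum]
  | succ d ih => rw [tailSum, ih, ih, sub_zero, mul_zero]

lemma tailSum_succ_succ (hb : ∀ s t, s ≤ t → intervalSum b s t ≠ 0) {t : ℕ} (ht : k ≤ t)
    {d L : ℕ} (hL : L + d ≤ k) :
    tailSum b k (t + 1) (d + 1) L = (intervalSum b L (t + 1))⁻¹ *
      (tailSum b k t (d + 1) L - tailSum b k (t + 1) d (k - d + 1)) := by
  have hsplit : intervalSum b L (k - d) + intervalSum b (k - d + 1) (t + 1) =
      intervalSum b L (t + 1) := intervalSum_add (by omega) (by omega)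
  have h1 := hb L (k - d) (by omega)
  have h2 := hb L (t + 1) (by omega)
  have h3 := hb (k - d + 1) (t + 1) (by omega)
  induction d generalizing L with
  | zero =>
    simp only [Nat.sub_zero] at *
    rw [tailSum_succ t, tailSum_succ (t + 1), Nat.sub_zero, tailSum_zero_succ ht,
      tailSum_zero_succ ht, ← hsplit]
    rw [← hsplit] at h2
    generalize tailSum b k t 0 L = u1 at *
    generalize tailSum b k t 0 (k + 1) = u2 at *
    generalize intervalSum b L k = p at *
    generalize intervalSum b (k + 1) (t + 1) = q at *
    field_simp
    ring
  | succ d ih =>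
    have hd : k - (d + 1) + 1 = k - d := by omega
    rw [tailSum_succ (t + 1), tailSum_succ t (d + 1)]
    rw [hd] at hsplit h3 ⊢
    have e1 := ih (L := L) (by omega) (intervalSum_add (by omega) (by omega))
      (hb _ _ (by omega)) h2 (hb _ _ (by omega))
    have e2 := ih (L := k - d) (by omega) (intervalSum_add (by omega) (by omega))
      (hb _ _ (by omega)) h3 (hb _ _ (by omega))
    rw [← hsplit] at h2 e1
    rw [← hsplit]
    generalize tailSum b k (t + 1) (d + 1) L = u1 at *
    generalize tailSum b k (t + 1) (d + 1) (k - d) = u2 at *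
    generalize tailSum b k t (d + 1) L = u3 at *
    generalize tailSum b k t (d + 1) (k - d) = u4 at *
    generalize tailSum b k (t + 1) d (k - d + 1) = u5 at *
    generalize intervalSum b L (k - (d + 1)) = p at *
    generalize intervalSum b (k - d) (t + 1) = q at *
    have e2' : u4 = q * u2 + u5 := by rw [e2]; field_simp; ring
    have e1' : u3 = (p + q) * u1 + u5 := by rw [e1]; field_simp; ring
    rw [e1', e2']
    field_simp
    ring

lemma tailSum_mem (hb : ∀ s t, s ≤ t → intervalSum b s t ≠ 0) (A : Subring K) {T : ℕ}
    (hA : ∀ s t, 1 ≤ s → s ≤ k + 1 → k + 1 ≤ t → t ≤ T → (intervalSum b s t)⁻¹ ∈ A)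
    {t : ℕ} (ht : k ≤ t) (htT : t ≤ T) {d : ℕ} (hd : d ≤ k) :
    tailSum b k t d (k - d + 1) ∈ A := by
  induction t, ht using Nat.le_induction generalizing d with
  | base =>
    cases d with
    | zero => simp [tailSum]
    | succ d => rw [tailSum_self_succ]; exact A.zero_mem
  | succ t ht ih =>
    induction d with
    | zero =>
      rw [tailSum_zero_succ ht]
      exact A.mul_mem (hA _ _ (by omega) (by omega) (by omega) htT) (ih (by omega) hd)
    | succ d ihd =>
      rw [tailSum_succ_succ hb ht (by omega)]
      exact A.mul_mem (hA _ _ (by omega) (by omega) (by omega) htT)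
        (A.sub_mem (ih (by omega) hd) (ihd (by omega)))

end IntervalSums

section BinarySequences

lemma Lidx_succ (k : ℕ) (ε : ℕ → Bool) (j : ℕ) :
    Lidx k ε (j + 1) = if deltaSeq k ε (j + 1) = true then j + 1 else Lidx k ε j := by
  unfold Lidx
  rw [Nat.findGreatest_succ]

lemma Lidx_one (k : ℕ) (ε : ℕ → Bool) : Lidx k ε 1 = 1 := by
  simp [Lidx_succ, deltaSeq]

lemma Lidx_add_two {k : ℕ} (ε : ℕ → Bool) {j : ℕ} (hj : j + 1 ≤ k) :
    Lidx k ε (j + 2) = if ε (j + 1) = true then j + 2 else Lidx k ε (j + 1) := by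
  have h : deltaSeq k ε (j + 2) = ε (j + 1) := by
    simp [deltaSeq, hj]
  rw [Lidx_succ, h]

lemma Lidx_of_le {k : ℕ} (ε : ℕ → Bool) {j : ℕ} (hj : k + 1 ≤ j) :
    Lidx k ε j = Lidx k ε (k + 1) := by
  induction j, hj using Nat.le_induction with
  | base => rfl
  | succ j hj ih =>
    have h : deltaSeq k ε (j + 1) = false := by
      simp only [deltaSeq]
      rw [if_neg (by omega), if_neg (by omega)]
    rw [Lidx_succ, h, ← ih]
    simp

lemma Lidx_congr (k : ℕ) {ε ε' : ℕ → Bool} {j : ℕ} (h : ∀ i < j, ε i = ε' i) :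
    Lidx k ε j = Lidx k ε' j := by
  induction j with
  | zero => simp [Lidx]
  | succ j ih =>
    have hδ : deltaSeq k ε (j + 1) = deltaSeq k ε' (j + 1) := by
      simp only [deltaSeq, Nat.add_sub_cancel, h j (Nat.lt_succ_self j)]
    rw [Lidx_succ, Lidx_succ, hδ, ih fun i hi => h i (by omega)]

lemma Lidx_le (k : ℕ) (ε : ℕ → Bool) (j : ℕ) : Lidx k ε j ≤ j :=
  Nat.findGreatest_le j

lemma exists_Lidx_eq {k s : ℕ} (hs : 1 ≤ s) (hsk : s ≤ k + 1) :
    ∃ ε : Fin k → Bool, ∀ j, k + 1 ≤ j → Lidx k (extSeq k ε) j = s := by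
  refine ⟨fun i => decide ((i : ℕ) + 2 = s), fun j hj => ?_⟩
  unfold Lidx
  rw [Nat.findGreatest_eq_iff]
  refine ⟨by omega, fun _ => ?_, fun n hn hnj => ?_⟩
  · simp only [deltaSeq, extSeq]
    split_ifs <;> first | rfl | (simp; omega) | omega
  · simp only [deltaSeq, extSeq]
    split_ifs <;> first | omega | (simp <;> omega)

lemma extSeq_snoc_of_le {n : ℕ} (c : Bool) (ε : Fin n → Bool) {i : ℕ} (hi : i ≤ n) :
    extSeq (n + 1) (Fin.snoc (α := fun _ => Bool) ε c) i = extSeq n ε i := by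
  unfold extSeq
  by_cases h : 1 ≤ i
  · rw [dif_pos (by omega), dif_pos (by omega)]
    simp only [Fin.snoc]
    rw [dif_pos (show i - 1 < n by omega)]
    rfl
  · rw [dif_neg (by omega), dif_neg (by omega)]

lemma extSeq_snoc_last {n : ℕ} (c : Bool) (ε : Fin n → Bool) :
    extSeq (n + 1) (Fin.snoc (α := fun _ => Bool) ε c) (n + 1) = c := by
  simp [extSeq, Fin.snoc]

lemma numOnes_snoc {n : ℕ} (c : Bool) (ε : Fin n → Bool) :
    numOnes (n + 1) (Fin.snoc (α := fun _ => Bool) ε c) = numOnes n ε + c.toNat := by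
  simp only [numOnes, Finset.card_filter, Fin.sum_univ_castSucc, Fin.snoc_castSucc, Fin.snoc_last]
  cases c <;> simp

end BinarySequences

section AlternatingSum

/-- The variable `b_ℓ` as an element of the fraction field. -/
def fieldVar (ℓ : ℕ) : FractionRing (MvPolynomial ℕ ℝ) :=
  algebraMap (MvPolynomial ℕ ℝ) (FractionRing (MvPolynomial ℕ ℝ)) (MvPolynomial.X ℓ)

lemma algebraMap_sum_X (s t : ℕ) :
    algebraMap (MvPolynomial ℕ ℝ) (FractionRing (MvPolynomial ℕ ℝ))
      (∑ ℓ ∈ Finset.Icc s t, MvPolynomial.X ℓ) = intervalSum fieldVar s t := by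
  simp [intervalSum, fieldVar]

lemma algebraMap_Mpoly (k : ℕ) (ε : ℕ → Bool) (j : ℕ) :
    algebraMap (MvPolynomial ℕ ℝ) (FractionRing (MvPolynomial ℕ ℝ)) (Mpoly k ε j) =
      intervalSum fieldVar (Lidx k ε j) j :=
  algebraMap_sum_X _ _

lemma sum_X_ne_zero {s t : ℕ} (hst : s ≤ t) :
    (∑ ℓ ∈ Finset.Icc s t, MvPolynomial.X ℓ : MvPolynomial ℕ ℝ) ≠ 0 := by
  intro h
  have h' := congrArg (MvPolynomial.eval fun _ => (1 : ℝ)) h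
  simp only [map_sum, MvPolynomial.eval_X, Finset.sum_const, Nat.card_Icc, nsmul_eq_mul, mul_one,
    map_zero, Nat.cast_eq_zero] at h'
  omega

lemma intervalSum_fieldVar_ne_zero (s t : ℕ) (hst : s ≤ t) : intervalSum fieldVar s t ≠ 0 := by
  rw [← algebraMap_sum_X]
  exact (map_ne_zero_iff _ (IsFractionRing.injective _ _)).2 (sum_X_ne_zero hst)

/-- The alternating sum of `P(ε; b)`, with the summation over `ε_{n+1}, …, ε_k` carried out
by `tailSum`. -/
def prefixSum (k t n : ℕ) : FractionRing (MvPolynomial ℕ ℝ) :=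
  ∑ ε : Fin n → Bool, (-1) ^ numOnes n ε *
    ((∏ j ∈ Finset.Icc 1 n, (intervalSum fieldVar (Lidx k (extSeq n ε) j) j)⁻¹) *
      tailSum fieldVar k t (k - n) (Lidx k (extSeq n ε) (n + 1)))

lemma prefixSum_succ {k n : ℕ} (t : ℕ) (hn : n + 1 ≤ k) :
    prefixSum k t (n + 1) = prefixSum k t n := by
  unfold prefixSum
  rw [← (Fin.snocEquiv fun _ => Bool).sum_comp, Fintype.sum_prod_type_right]
  refine Finset.sum_congr rfl fun ε _ => ?_
  have hsnoc : ∀ c, (Fin.snocEquiv fun _ : Fin (n + 1) => Bool) (c, ε) =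
      Fin.snoc (α := fun _ => Bool) ε c := fun _ => rfl
  have hL : ∀ c, ∀ j ≤ n + 1, Lidx k (extSeq (n + 1) (Fin.snoc (α := fun _ => Bool) ε c)) j =
      Lidx k (extSeq n ε) j := fun c j hj =>
    Lidx_congr k fun i hi => extSeq_snoc_of_le c ε (by omega)
  have hprod : ∀ c, ∏ j ∈ Finset.Icc 1 (n + 1), (intervalSum fieldVar
      (Lidx k (extSeq (n + 1) (Fin.snoc (α := fun _ => Bool) ε c)) j) j)⁻¹ =
      (∏ j ∈ Finset.Icc 1 n, (intervalSum fieldVar (Lidx k (extSeq n ε) j) j)⁻¹) *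
        (intervalSum fieldVar (Lidx k (extSeq n ε) (n + 1)) (n + 1))⁻¹ := by
    intro c
    rw [← Finset.prod_Icc_succ_top (by omega)]
    refine Finset.prod_congr rfl fun j hj => ?_
    rw [hL c j (Finset.mem_Icc.1 hj).2]
  obtain ⟨d, rfl⟩ : ∃ d, k = n + 1 + d := ⟨k - (n + 1), by omega⟩
  have e1 : n + 1 + d - n = d + 1 := by omega
  have e2 : n + 1 + d - (n + 1) = d := by omega
  have e3 : n + 1 + d - d = n + 1 := by omega
  simp only [Fintype.sum_bool, hsnoc, hprod, numOnes_snoc, Lidx_add_two _ hn, extSeq_snoc_last,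
    hL _ _ le_rfl, e1, e2, tailSum, e3]
  simp [pow_succ]
  ring

lemma Qfun_eq_tailSum (k m : ℕ) : Qfun k m = tailSum fieldVar k (k + m) k 1 := by
  have hconst : ∀ n ≤ k, prefixSum k (k + m) n = prefixSum k (k + m) 0 := by
    intro n
    induction n with
    | zero => intro _; rfl
    | succ n ih => intro hn; rw [prefixSum_succ _ hn, ih (by omega)]
  have hzero : prefixSum k (k + m) 0 = tailSum fieldVar k (k + m) k 1 := by
    simp [prefixSum, numOnes, Lidx_one]
  rw [← hzero, ← hconst k le_rfl]
  unfold Qfun prefixSum Pfun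
  refine Finset.sum_congr rfl fun ε _ => ?_
  rw [Nat.sub_self, tailSum]
  congr 1
  simp only [algebraMap_Mpoly]
  have htail : ∏ j ∈ Finset.Icc (k + 1) (k + m),
      (intervalSum fieldVar (Lidx k (extSeq k ε) (k + 1)) j)⁻¹ =
      ∏ j ∈ Finset.Icc (k + 1) (k + m),
        (intervalSum fieldVar (Lidx k (extSeq k ε) j) j)⁻¹ :=
    Finset.prod_congr rfl fun j hj => by rw [Lidx_of_le _ (Finset.mem_Icc.1 hj).1]
  rw [htail, ← Finset.prod_union]
  · congr 1
    ext i
    simp only [Finset.mem_union, Finset.mem_Icc]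
    omega
  · rw [Finset.disjoint_left]
    intro i
    simp only [Finset.mem_Icc]
    omega

/-- The multiplicative set generated by the linear forms `M(ε; b; j)` with `k < j ≤ k + m`. -/
def formMonoid (k m : ℕ) : Submonoid (MvPolynomial ℕ ℝ) :=
  Submonoid.closure {q | ∃ (ε : Fin k → Bool) (j : ℕ), k + 1 ≤ j ∧ j ≤ k + m ∧
    q = Mpoly k (extSeq k ε) j}

lemma formMonoid_le_nonZeroDivisors (k m : ℕ) :
    formMonoid k m ≤ nonZeroDivisors (MvPolynomial ℕ ℝ) := by
  refine Submonoid.closure_le.2 ?_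
  rintro _ ⟨ε, j, -, -, rfl⟩
  exact mem_nonZeroDivisors_of_ne_zero (sum_X_ne_zero (Lidx_le _ _ _))

lemma exists_Qfun_eq_div (k m : ℕ) : ∃ f g : MvPolynomial ℕ ℝ, g ∈ formMonoid k m ∧
    Qfun k m = algebraMap (MvPolynomial ℕ ℝ) (FractionRing (MvPolynomial ℕ ℝ)) f /
      algebraMap (MvPolynomial ℕ ℝ) (FractionRing (MvPolynomial ℕ ℝ)) g := by
  have hmem := tailSum_mem (k := k) (d := k) intervalSum_fieldVar_ne_zero
    (Localization.subalgebra.ofField (FractionRing (MvPolynomial ℕ ℝ)) (formMonoid k m)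
      (formMonoid_le_nonZeroDivisors k m)).toSubring (T := k + m) ?_
    (Nat.le_add_right k m) le_rfl le_rfl
  · rw [Nat.sub_self, zero_add, ← Qfun_eq_tailSum] at hmem
    obtain ⟨f, g, hg, h⟩ := hmem
    exact ⟨f, g, hg, by rw [h, div_eq_mul_inv]⟩
  · intro s t hs hsk hkt htm
    obtain ⟨ε, hε⟩ := exists_Lidx_eq hs hsk
    refine ⟨1, Mpoly k (extSeq k ε) t, Submonoid.subset_closure ⟨ε, t, hkt, htm, rfl⟩, ?_⟩
    rw [algebraMap_Mpoly, hε t hkt, map_one, one_mul]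

end AlternatingSum

section Evaluation

lemma evalC_mul (k m : ℕ) (p q : MvPolynomial ℕ ℝ) (z : Fin (k + m) → ℂ) :
    evalC k m (p * q) z = evalC k m p z * evalC k m q z := by
  simp [evalC]

lemma evalC_ne_zero_of_mem_formMonoid {k m : ℕ} {g : MvPolynomial ℕ ℝ} (hg : g ∈ formMonoid k m)
    {p : Fin (k + m) → ℂ} (hp : ∀ (ε : Fin k → Bool) (j : ℕ), k + 1 ≤ j → j ≤ k + m →
      evalC k m (Mpoly k (extSeq k ε) j) p ≠ 0) : evalC k m g p ≠ 0 := by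
  induction hg using Submonoid.closure_induction with
  | mem q hq =>
    obtain ⟨ε, j, h1, h2, rfl⟩ := hq
    exact hp ε j h1 h2
  | one => simp [evalC]
  | mul q r _ _ hq hr => rw [evalC_mul]; exact mul_ne_zero hq hr

lemma analyticAt_evalC (k m : ℕ) (q : MvPolynomial ℕ ℝ) (p : Fin (k + m) → ℂ) :
    AnalyticAt ℂ (evalC k m q) p := by
  unfold evalC
  simp only [MvPolynomial.eval_map]
  refine AnalyticAt.aeval_mvPolynomial (A := ℝ) (fun i => ?_) q
  by_cases h : 1 ≤ i ∧ i ≤ k + m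
  · simp only [h, and_self, dite_true]
    exact (ContinuousLinearMap.proj (R := ℂ) (φ := fun _ : Fin (k + m) => ℂ) _).analyticAt p
  · simp only [h, dite_false]
    exact analyticAt_const

/-- The point with `a = 0` and `x = (1, …, 1)`. -/
def onesPoint (k m : ℕ) (i : Fin (k + m)) : ℂ := if (i : ℕ) < k then 0 else 1

lemma evalC_Mpoly_onesPoint_of_le {k m : ℕ} (ε : ℕ → Bool) {t : ℕ} (ht : t ≤ k) :
    evalC k m (Mpoly k ε t) (onesPoint k m) = 0 := by
  simp only [evalC, Mpoly, map_sum, MvPolynomial.map_X, MvPolynomial.eval_X]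
  refine Finset.sum_eq_zero fun i hi => ?_
  have := (Finset.mem_Icc.1 hi).2
  split_ifs with h
  · simp only [onesPoint]
    rw [if_pos (by omega)]
  · rfl

lemma evalC_Mpoly_onesPoint_ne_zero {k m : ℕ} (ε : ℕ → Bool) {j : ℕ} (hj : k + 1 ≤ j)
    (hjm : j ≤ k + m) : evalC k m (Mpoly k ε j) (onesPoint k m) ≠ 0 := by
  simp only [evalC, Mpoly, map_sum, MvPolynomial.map_X, MvPolynomial.eval_X]
  have hval : ∀ i, (if h : 1 ≤ i ∧ i ≤ k + m then onesPoint k m ⟨i - 1, by omega⟩ else 0) =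
      ((if k + 1 ≤ i ∧ i ≤ k + m then 1 else 0 : ℕ) : ℂ) := by
    intro i
    simp only [onesPoint]
    split_ifs <;> first | omega | simp
  simp only [hval]
  rw [← Nat.cast_sum, Nat.cast_ne_zero]
  have hle := Finset.single_le_sum (f := fun i => if k + 1 ≤ i ∧ i ≤ k + m then 1 else 0)
    (fun _ _ => Nat.zero_le _) (Finset.right_mem_Icc.2 (Lidx_le k ε j))
  simp only [hj, hjm, and_self, if_true] at hle
  omega

end Evaluation

theorem alg_lemma_three (k m : ℕ) (hk : 1 ≤ k) (hm : 1 ≤ m) :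
    ∃ f g : MvPolynomial ℕ ℝ,
      -- no `M(ε';b;t)` with `1 ≤ t ≤ k` divides `g`
      (∀ (ε' : Fin k → Bool) (t : ℕ), 1 ≤ t → t ≤ k →
        ¬ (Mpoly k (extSeq k ε') t ∣ g)) ∧
      -- `Q = f / g`
      Qfun k m =
        algebraMap (MvPolynomial ℕ ℝ) (FractionRing (MvPolynomial ℕ ℝ)) f /
          algebraMap (MvPolynomial ℕ ℝ) (FractionRing (MvPolynomial ℕ ℝ)) g ∧
      -- in particular `Q` is holomorphic near every point with `a⁰ = 0` at which no
      -- linear form `M(ε';b;j)`, `j > k`, vanishes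
      (∀ p : Fin (k + m) → ℂ,
        (∀ i : Fin (k + m), (i : ℕ) < k → p i = 0) →
        (∀ (ε' : Fin k → Bool) (j : ℕ), k + 1 ≤ j → j ≤ k + m →
          evalC k m (Mpoly k (extSeq k ε') j) p ≠ 0) →
        evalC k m g p ≠ 0 ∧
          AnalyticAt ℂ (fun z : Fin (k + m) → ℂ => evalC k m f z / evalC k m g z) p) := by
  obtain ⟨f, g, hg, hQ⟩ := exists_Qfun_eq_div k m
  refine ⟨f, g, fun ε' t _ ht hdvd => ?_, hQ, fun p _ hp => ?_⟩
  · obtain ⟨r, rfl⟩ := hdvd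
    refine evalC_ne_zero_of_mem_formMonoid hg (p := onesPoint k m)
      (fun ε j hj hjm => evalC_Mpoly_onesPoint_ne_zero _ hj hjm) ?_
    rw [evalC_mul, evalC_Mpoly_onesPoint_of_le _ ht, zero_mul]
  · have hne := evalC_ne_zero_of_mem_formMonoid hg hp
    exact ⟨hne, (analyticAt_evalC k m f p).div (analyticAt_evalC k m g p) hne⟩
end
end
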